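/- arXiv:1407.5827 — 2 statements merged into one kernel-verified Lean document; each statement's English description precedes it below -/
import Mathlib

section
/- Let q ≥ 16 be an integer and let c ∈ {2, 3}. Then 2^(q·c) · p(q)^c · c ≤ 5^((2·q·c − 1)/3); equivalently, (2^(q·c) · p(q)^c · c)^3 ≤ 5^(2·q·c − 1). -/
/-- The number of partitions of `n` into parts that are all at least `k` (for `k ≥ 1`). -/
def partitionsMinPart (k n : ℕ) : ℕ :=
  if n = 0 then 1
  else if k = 0 ∨ n < k then 0
  else partitionsMinPart k (n - k) + partitionsMinPart (k + 1) n
termination_by 2 * n + 1 - k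

theorem partitionsMinPart_zero_right (k : ℕ) : partitionsMinPart k 0 = 1 := by
  rw [partitionsMinPart]; simp

theorem partitionsMinPart_of_lt {k n : ℕ} (hn : n ≠ 0) (h : n < k) :
    partitionsMinPart k n = 0 := by
  rw [partitionsMinPart]; simp [hn, h]

theorem partitionsMinPart_of_le {k n : ℕ} (hk : k ≠ 0) (h : k ≤ n) :
    partitionsMinPart k n = partitionsMinPart k (n - k) + partitionsMinPart (k + 1) n := by
  have h₁ : n ≠ 0 := by lia
  have h₂ : ¬(k = 0 ∨ n < k) := by lia
  rw [partitionsMinPart, if_neg h₁, if_neg h₂]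

/-- Lowering a smallest part by one. -/
theorem partitionsMinPart_succ_succ_le (k n : ℕ) (hk : k ≠ 0) (h : k ≤ n) :
    partitionsMinPart (k + 1) (n + 1) ≤ partitionsMinPart k n := by
  rw [partitionsMinPart_of_le hk h, partitionsMinPart_of_le (by lia) (by lia),
    Nat.add_sub_add_right]
  refine Nat.add_le_add ?_ ?_
  · rcases Nat.eq_zero_or_pos (n - k) with h₀ | h₀
    · simp [h₀, partitionsMinPart_zero_right]
    · rcases Nat.lt_or_ge (n - k) k with h₁ | h₁
      · simp [partitionsMinPart_of_lt (k := k + 1) h₀.ne' (by lia)]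
      · rw [partitionsMinPart_of_le hk h₁]
        exact Nat.le_add_left _ _
  · rcases h.eq_or_lt with h₀ | h₀
    · simp [partitionsMinPart_of_lt (k := k + 1 + 1) (n := n + 1) (by lia) (by lia)]
    · exact partitionsMinPart_succ_succ_le (k + 1) n (by lia) h₀
termination_by n - k

namespace Nat.Partition

/-- The partition of `n + k` obtained by adding a part `k` to a partition of `n`. -/
def consPart {n : ℕ} (k : ℕ) (hk : 0 < k) (p : n.Partition) : (n + k).Partition where
  parts := k ::ₘ p.parts
  parts_pos hi := by
    rcases Multiset.mem_cons.1 hi with rfl | hi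
    · exact hk
    · exact p.parts_pos hi
  parts_sum := by rw [Multiset.sum_cons, p.parts_sum, add_comm]

theorem card_filter_le_partitionsMinPart (k n : ℕ) (hk : k ≠ 0) :
    (Finset.univ.filter fun p : n.Partition => ∀ i ∈ p.parts, k ≤ i).card ≤
      partitionsMinPart k n := by
  rcases Nat.eq_zero_or_pos n with rfl | hn
  · rw [partitionsMinPart_zero_right]
    exact Finset.card_le_one_of_subsingleton _
  rcases Nat.lt_or_ge n k with h | h
  · rw [partitionsMinPart_of_lt hn.ne' h, Nat.le_zero, Finset.card_eq_zero,
      Finset.filter_eq_empty_iff]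
    intro p _ hp
    obtain ⟨i, hi⟩ : ∃ i, i ∈ p.parts := by
      refine Multiset.exists_mem_of_ne_zero fun h₀ => hn.ne' ?_
      rw [← p.parts_sum, h₀, Multiset.sum_zero]
    have := hp i hi
    have := le_of_mem_parts hi
    lia
  · obtain ⟨m, rfl⟩ := Nat.exists_eq_add_of_le' h
    have ih₁ := card_filter_le_partitionsMinPart k m hk
    have ih₂ := card_filter_le_partitionsMinPart (k + 1) (m + k) (by lia)
    rw [partitionsMinPart_of_le hk h, Nat.add_sub_cancel]
    refine le_trans (Finset.card_le_card ?_) <| (Finset.card_union_le _ _).trans <|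
      Nat.add_le_add ((Finset.card_image_le (f := consPart k (Nat.pos_of_ne_zero hk))).trans ih₁)
        ih₂
    intro p hp
    simp only [Finset.mem_filter, Finset.mem_univ, true_and, Finset.mem_union,
      Finset.mem_image] at hp ⊢
    by_cases hkp : k ∈ p.parts
    · obtain ⟨s, hs⟩ := Multiset.exists_cons_of_mem hkp
      refine Or.inl ⟨⟨s, fun hi => p.parts_pos (hs ▸ Multiset.mem_cons_of_mem hi), ?_⟩, ?_, ?_⟩
      · have := p.parts_sum
        rw [hs, Multiset.sum_cons] at this
        lia
      · exact fun i hi => hp i (hs ▸ Multiset.mem_cons_of_mem hi)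
      · exact Nat.Partition.ext hs.symm
    · exact Or.inr fun i hi => (hp i hi).lt_of_ne fun h₀ => hkp (h₀ ▸ hi)
termination_by 2 * n + 1 - k

theorem card_le_partitionsMinPart_one (n : ℕ) :
    Fintype.card n.Partition ≤ partitionsMinPart 1 n := by
  refine le_trans (le_of_eq ?_) (card_filter_le_partitionsMinPart 1 n one_ne_zero)
  rw [← Finset.card_univ, Finset.filter_true_of_mem]
  exact fun p _ i hi => p.parts_pos hi

end Nat.Partition

theorem partitionsMinPart_bounds (n : ℕ) (hn : 16 ≤ n) :
    1000 * 5 ^ n * partitionsMinPart 1 n ≤ 1070 * 7 ^ n ∧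
    1000 * 5 ^ n * partitionsMinPart 2 n ≤ 305 * 7 ^ n ∧
    1000 * 5 ^ n * partitionsMinPart 3 n ≤ 149 * 7 ^ n ∧
    1000 * 5 ^ n * partitionsMinPart 4 n ≤ 94 * 7 ^ n := by
  rcases Nat.lt_or_ge n 20 with h | h
  · interval_cases n <;> decide +kernel
  · obtain ⟨m, rfl⟩ := Nat.exists_eq_add_of_le' (show 4 ≤ n by lia)
    have h₀ := partitionsMinPart_bounds m (by lia)
    have h₁ := partitionsMinPart_bounds (m + 1) (by lia)
    have h₂ := partitionsMinPart_bounds (m + 2) (by lia)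
    have h₃ := partitionsMinPart_bounds (m + 3) (by lia)
    have e₁ := partitionsMinPart_of_le (k := 1) (n := m + 4) (by lia) (by lia)
    have e₂ := partitionsMinPart_of_le (k := 2) (n := m + 4) (by lia) (by lia)
    have e₃ := partitionsMinPart_of_le (k := 3) (n := m + 4) (by lia) (by lia)
    have e₄ := partitionsMinPart_of_le (k := 4) (n := m + 4) (by lia) (by lia)
    have e₅ := partitionsMinPart_succ_succ_le 4 (m + 3) (by lia) (by lia)
    simp only [Nat.add_sub_cancel, Nat.reduceAdd, Nat.reduceSubDiff]
      at e₁ e₂ e₃ e₄ e₅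
    have b₄ : 1000 * 5 ^ (m + 4) * partitionsMinPart 4 (m + 4) ≤ 94 * 7 ^ (m + 4) := by
      have := Nat.mul_le_mul_left (1000 * 5 ^ (m + 4)) e₅
      rw [e₄]
      simp only [pow_add] at *
      lia
    have b₃ : 1000 * 5 ^ (m + 4) * partitionsMinPart 3 (m + 4) ≤ 149 * 7 ^ (m + 4) := by
      rw [e₃]
      simp only [pow_add] at *
      lia
    have b₂ : 1000 * 5 ^ (m + 4) * partitionsMinPart 2 (m + 4) ≤ 305 * 7 ^ (m + 4) := by
      rw [e₂]
      simp only [pow_add] at *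
      lia
    refine ⟨?_, b₂, b₃, b₄⟩
    rw [e₁]
    simp only [pow_add] at *
    lia

theorem hundred_mul_five_pow_mul_card_partition_le {n : ℕ} (hn : 16 ≤ n) :
    100 * 5 ^ n * Fintype.card n.Partition ≤ 107 * 7 ^ n := by
  have h₁ := (partitionsMinPart_bounds n hn).1
  have h₂ := Nat.mul_le_mul_left (1000 * 5 ^ n) (Nat.Partition.card_le_partitionsMinPart_one n)
  lia

/-- A comparison of two geometric sequences extends from its term at `N` to all later terms. -/
theorem mul_pow_le_mul_pow_of_le {a b x y N n : ℕ} (hxy : x ≤ y) (hN : N ≤ n)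
    (h : a * x ^ N ≤ b * y ^ N) : a * x ^ n ≤ b * y ^ n := by
  obtain ⟨m, rfl⟩ := Nat.exists_eq_add_of_le hN
  rw [pow_add, pow_add, ← mul_assoc, ← mul_assoc]
  exact Nat.mul_le_mul h (Nat.pow_le_pow_left hxy m)

/-- For `q ≥ 16` and `c ∈ {2, 3}`, `2^(q·c) · p(q)^c · c ≤ 5^((2·q·c − 1)/3)`;
equivalently, `(2^(q·c) · p(q)^c · c)^3 ≤ 5^(2·q·c − 1)`. -/
theorem two_pow_mul_partition_pow_le (q c : ℕ) (hq : 16 ≤ q)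
    (hc : c = 2 ∨ c = 3) :
    (2 ^ (q * c) * Fintype.card (Nat.Partition q) ^ c * c) ^ 3 ≤
      5 ^ (2 * q * c - 1) := by
  have hp := hundred_mul_five_pow_mul_card_partition_le hq
  set p := Fintype.card (Nat.Partition q)
  have hgeom : c ^ 3 * 5 * 107 ^ (3 * c) * (2 ^ (3 * c) * 7 ^ (3 * c)) ^ q ≤
      100 ^ (3 * c) * (5 ^ (2 * c) * 5 ^ (3 * c)) ^ q := by
    rcases hc with rfl | rfl <;>
      exact mul_pow_le_mul_pow_of_le (by norm_num) hq (by norm_num)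
  have hpow : 5 ^ (2 * q * c) = 5 ^ (2 * q * c - 1) * 5 := by
    rw [← pow_succ, Nat.sub_add_cancel]
    rcases hc with rfl | rfl <;> lia
  refine Nat.le_of_mul_le_mul_right (c := 5 * (100 * 5 ^ q) ^ (3 * c)) ?_ (by positivity)
  calc (2 ^ (q * c) * p ^ c * c) ^ 3 * (5 * (100 * 5 ^ q) ^ (3 * c))
      = c ^ 3 * 5 * 2 ^ (3 * c * q) * (100 * 5 ^ q * p) ^ (3 * c) := by ring
    _ ≤ c ^ 3 * 5 * 2 ^ (3 * c * q) * (107 * 7 ^ q) ^ (3 * c) := by gcongr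
    _ = c ^ 3 * 5 * 107 ^ (3 * c) * (2 ^ (3 * c) * 7 ^ (3 * c)) ^ q := by ring
    _ ≤ 100 ^ (3 * c) * (5 ^ (2 * c) * 5 ^ (3 * c)) ^ q := hgeom
    _ = 5 ^ (2 * q * c) * (100 * 5 ^ q) ^ (3 * c) := by ring
    _ = 5 ^ (2 * q * c - 1) * (5 * (100 * 5 ^ q) ^ (3 * c)) := by rw [hpow, mul_assoc]
end

section
/- Every subgroup H of the general linear group GL(5, F₂) of invertible 5×5 matrices over the field with two elements has fewer than 260 conjugacy classes, i.e. k(H) < 260. -/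
section Classes

variable {K : Type*} [Group K]

theorem IsPGroup.exists_conj_mem_sylow [Finite K] {p : ℕ} [Fact p.Prime] {Q : Subgroup K}
    (hQ : IsPGroup p Q) (T : Sylow p K) : ∃ g : K, ∀ q ∈ Q, g * q * g⁻¹ ∈ T := by
  obtain ⟨R, hR⟩ := hQ.exists_le_sylow
  obtain ⟨g, rfl⟩ := MulAction.exists_smul_eq K R T
  exact ⟨g, fun q hq => Subgroup.smul_mem_pointwise_smul q (MulAut.conj g) _ (hR hq)⟩

theorem exists_conj_mem_sylow_of_orderOf_eq_pow [Finite K] {p k : ℕ} [Fact p.Prime] {s : K}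
    (hs : orderOf s = p ^ k) (T : Sylow p K) : ∃ g : K, g * s * g⁻¹ ∈ T := by
  have hQ : IsPGroup p (Subgroup.zpowers s) :=
    IsPGroup.of_card (n := k) (by rw [Nat.card_zpowers, hs])
  obtain ⟨g, hg⟩ := hQ.exists_conj_mem_sylow T
  exact ⟨g, hg s (Subgroup.mem_zpowers s)⟩

theorem exists_eq_mul_prime_parts [Finite K] (p : ℕ) [hp : Fact p.Prime] (x : K) :
    ∃ s y : K, x = s * y ∧ Commute s y ∧ (∃ k, orderOf s = p ^ k) ∧ ¬ p ∣ orderOf y ∧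
      orderOf y ∣ orderOf x := by
  obtain ⟨k, m, hm, hn⟩ :=
    Nat.exists_eq_pow_mul_and_not_dvd (orderOf_pos x).ne' p hp.out.ne_one
  have hco : Nat.Coprime (p ^ k) m := Nat.Coprime.pow_left _ ((hp.out.coprime_iff_not_dvd).2 hm)
  obtain ⟨e, he1, he2⟩ := Nat.chineseRemainder hco 1 0
  obtain ⟨f, hf1, hf2⟩ := Nat.chineseRemainder hco 0 1
  have hy : orderOf (x ^ f) ∣ m := by
    apply orderOf_dvd_of_pow_eq_one
    rw [← pow_mul, ← orderOf_dvd_iff_pow_eq_one, hn]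
    exact Nat.mul_dvd_mul_right ((Nat.modEq_zero_iff_dvd).1 hf1) m
  refine ⟨x ^ e, x ^ f, ?_, Commute.pow_pow_self x e f, ?_, fun h => hm (h.trans hy),
    orderOf_pow_dvd f⟩
  · have h1 : e + f ≡ 1 [MOD orderOf x] := by
      rw [hn]
      exact (Nat.modEq_and_modEq_iff_modEq_mul hco).1 ⟨he1.add hf1, he2.add hf2⟩
    rw [← pow_add, pow_eq_pow_iff_modEq.2 h1, pow_one]
  · have h1 : orderOf (x ^ e) ∣ p ^ k := by
      apply orderOf_dvd_of_pow_eq_one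
      rw [← pow_mul, ← orderOf_dvd_iff_pow_eq_one, hn, mul_comm e]
      exact Nat.mul_dvd_mul_left _ ((Nat.modEq_zero_iff_dvd).1 he2)
    obtain ⟨j, -, hj⟩ := (Nat.dvd_prime_pow hp.out).1 h1
    exact ⟨j, hj⟩

/-- A set of conjugacy classes is bounded by counting a set of representatives of the form
`s * y`, with `s` in a finite set and `y` in a set depending on `s`. -/
theorem ncard_conjClasses_le_sum [Finite K] (T : Finset K) (S : K → Set K)
    (C : Set (ConjClasses K))
    (h : ∀ x : K, ConjClasses.mk x ∈ C → ∃ s ∈ T, ∃ y ∈ S s, IsConj (s * y) x) :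
    C.ncard ≤ ∑ s ∈ T, (S s).ncard := by
  have hsub : C ⊆ ⋃ s ∈ T, (fun y => ConjClasses.mk (s * y)) '' S s := by
    intro c hc
    obtain ⟨x, rfl⟩ := ConjClasses.exists_rep c
    obtain ⟨s, hs, y, hy, hxy⟩ := h x hc
    exact Set.mem_biUnion hs ⟨y, hy, ConjClasses.mk_eq_mk_iff_isConj.2 hxy⟩
  refine (Set.ncard_le_ncard hsub (Set.toFinite _)).trans ?_
  refine (Finset.set_ncard_biUnion_le T _).trans (Finset.sum_le_sum fun s _ => ?_)
  exact Set.ncard_image_le (Set.toFinite _)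

theorem mul_ncard_commute_not_dvd_orderOf_le [Finite K] {p k : ℕ} [hp : Fact p.Prime] {s : K}
    (hs : orderOf s = p ^ k) (hs1 : s ≠ 1) :
    p * {y : K | Commute s y ∧ ¬ p ∣ orderOf y}.ncard ≤ Nat.card (Subgroup.centralizer {s}) := by
  have hple : p ≤ Nat.card (Subgroup.zpowers s) := by
    rw [Nat.card_zpowers, hs]
    refine Nat.le_self_pow ?_ p
    rintro rfl
    exact hs1 (orderOf_eq_one_iff.1 (by simpa using hs))
  rw [← Nat.card_coe_set_eq]
  refine (Nat.mul_le_mul_right _ hple).trans ?_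
  rw [← Nat.card_prod]
  refine Nat.card_le_card_of_injective
    (fun z => ⟨(z.1 : K) * z.2, ?_⟩) ?_
  · obtain ⟨⟨z, hz⟩, ⟨y, hy⟩⟩ := z
    obtain ⟨i, rfl⟩ := hz
    rw [Subgroup.mem_centralizer_singleton_iff]
    exact (((Commute.refl s).zpow_right i).mul_right hy.1).eq.symm
  · rintro ⟨⟨z, hz⟩, ⟨y, hy⟩⟩ ⟨⟨z', hz'⟩, ⟨y', hy'⟩⟩ h
    simp only [Subtype.mk.injEq] at h
    have key : ∀ u : K, u ∈ Subgroup.zpowers s → ∀ y y' : K, ¬ p ∣ orderOf y →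
        ¬ p ∣ orderOf y' → Commute s y → u * y = y' → u = 1 := by
      rintro u ⟨i, rfl⟩ y y' h1 h2 h3 rfl
      have hc : Commute (s ^ i) y := h3.zpow_left i
      have hd : (s ^ i) ^ (orderOf y * orderOf (s ^ i * y)) = 1 := by
        have := pow_orderOf_eq_one (s ^ i * y)
        have h5 : (s ^ i * y) ^ (orderOf y * orderOf (s ^ i * y)) = 1 := by
          rw [mul_comm, pow_mul, this, one_pow]
        rwa [hc.mul_pow, pow_mul y, pow_orderOf_eq_one, one_pow, mul_one] at h5
      have h6 : orderOf (s ^ i) ∣ p ^ k := hs ▸ orderOf_dvd_of_mem_zpowers ⟨i, rfl⟩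
      have h7 := orderOf_dvd_of_pow_eq_one hd
      have h8 : Nat.Coprime (p ^ k) (orderOf y * orderOf (s ^ i * y)) :=
        Nat.Coprime.pow_left _ (Nat.Coprime.mul_right ((hp.out.coprime_iff_not_dvd).2 h1)
          ((hp.out.coprime_iff_not_dvd).2 h2))
      exact orderOf_eq_one_iff.1 (Nat.eq_one_of_dvd_coprimes h8 h6 h7)
    have h9 := key (z'⁻¹ * z) (mul_mem (inv_mem hz') hz) y y' hy.2 hy'.2 hy.1
      (by rw [mul_assoc, h, inv_mul_cancel_left])
    have h10 : z = z' := (inv_mul_eq_one.1 h9).symm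
    subst h10
    simpa using h

theorem ncard_conjClasses_dvd_orderOf_le [Finite K] {p : ℕ} [hp : Fact p.Prime] (T : Sylow p K)
    (hT : Nat.card T ≤ p) {c : ℕ}
    (hc : ∀ s : K, s ∈ T → s ≠ 1 → Nat.card (Subgroup.centralizer {s}) ≤ p * c) :
    {C : ConjClasses K | ∃ x, ConjClasses.mk x = C ∧ p ∣ orderOf x}.ncard ≤ (p - 1) * c := by
  classical
  have hfin : ((T : Set K) \ {1}).Finite := Set.toFinite _
  have h1 := ncard_conjClasses_le_sum hfin.toFinset
    (fun s => {y : K | Commute s y ∧ ¬ p ∣ orderOf y})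
    {C : ConjClasses K | ∃ x, ConjClasses.mk x = C ∧ p ∣ orderOf x} ?_
  · refine h1.trans ?_
    refine (Finset.sum_le_card_nsmul _ _ c ?_).trans ?_
    · intro s hs
      simp only [Set.Finite.mem_toFinset, Set.mem_sdiff, SetLike.mem_coe,
        Set.mem_singleton_iff] at hs
      obtain ⟨k, hk⟩ := (IsPGroup.iff_orderOf.1 T.isPGroup') ⟨s, hs.1⟩
      rw [Subgroup.orderOf_mk] at hk
      exact Nat.le_of_mul_le_mul_left
        ((mul_ncard_commute_not_dvd_orderOf_le hk hs.2).trans (hc s hs.1 hs.2)) hp.out.pos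
    · rw [smul_eq_mul, ← Set.ncard_eq_toFinset_card]
      refine Nat.mul_le_mul_right _ ?_
      rw [Set.ncard_sdiff_singleton_of_mem (one_mem T)]
      exact Nat.sub_le_sub_right hT 1
  · rintro x ⟨x', hxx', hx'⟩
    obtain ⟨s, y, rfl, hsy, ⟨k, hk⟩, hy, -⟩ := exists_eq_mul_prime_parts p x'
    obtain ⟨g, hg⟩ := exists_conj_mem_sylow_of_orderOf_eq_pow hk T
    have hs1 : s ≠ 1 := by
      rintro rfl
      exact hy (by simpa using hx')
    refine ⟨g * s * g⁻¹, ?_, g * y * g⁻¹, ⟨?_, ?_⟩, ?_⟩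
    · simpa [conj_eq_one_iff] using And.intro hg hs1
    · exact hsy.map (MulAut.conj g)
    · have : orderOf (g * y * g⁻¹) = orderOf y :=
        orderOf_injective (MulAut.conj g).toMonoidHom (MulAut.conj g).injective y
      rwa [this]
    · refine IsConj.trans ?_ (ConjClasses.mk_eq_mk_iff_isConj.1 hxx')
      exact (isConj_iff.2 ⟨g, by group⟩ : IsConj (s * y) _).symm

theorem ncard_conjClasses_orderOf_eq_pow_mul_le [Finite K] {q p : ℕ} [hq : Fact q.Prime]
    [hp : Fact p.Prime] (T : Sylow p K) :
    {C : ConjClasses K | ∃ x, ConjClasses.mk x = C ∧ p ∣ orderOf x ∧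
      ∀ l : ℕ, l.Prime → l ∣ orderOf x → l = q ∨ l = p}.ncard ≤
    ∑ s ∈ ((T : Set K) \ {1}).toFinite.toFinset,
      q ^ (Nat.card (Subgroup.centralizer {s})).factorization q := by
  classical
  have Q (s : K) : Sylow q (Subgroup.centralizer {s}) := default
  have h1 := ncard_conjClasses_le_sum ((T : Set K) \ {1}).toFinite.toFinset
    (fun s => (Subtype.val '' (Q s : Set (Subgroup.centralizer {s}))))
    {C : ConjClasses K | ∃ x, ConjClasses.mk x = C ∧ p ∣ orderOf x ∧
      ∀ l : ℕ, l.Prime → l ∣ orderOf x → l = q ∨ l = p} ?_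
  · refine h1.trans (Finset.sum_le_sum fun s _ => ?_)
    refine (Set.ncard_image_le (Set.toFinite _)).trans ?_
    rw [← (Q s).card_eq_multiplicity, ← Nat.card_coe_set_eq]
    rfl
  · rintro x ⟨x', hxx', hx', hl⟩
    obtain ⟨s, y, rfl, hsy, ⟨k, hk⟩, hy, hyx⟩ := exists_eq_mul_prime_parts p x'
    obtain ⟨g, hg⟩ := exists_conj_mem_sylow_of_orderOf_eq_pow hk T
    have hs1 : s ≠ 1 := by
      rintro rfl
      exact hy (by simpa using hx')
    have hyq : ∃ j, orderOf y = q ^ j := by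
      refine ⟨_, Nat.eq_prime_pow_of_unique_prime_dvd (orderOf_pos y).ne' fun {l} hlp hly => ?_⟩
      rcases hl l hlp (hly.trans hyx) with h | h
      · exact h
      · exact absurd (h ▸ hly) hy
    obtain ⟨j, hj⟩ := hyq
    have hcomm : Commute (g * s * g⁻¹) (g * y * g⁻¹) := hsy.map (MulAut.conj g)
    have hyc : g * y * g⁻¹ ∈ Subgroup.centralizer {g * s * g⁻¹} := by
      rw [Subgroup.mem_centralizer_singleton_iff]
      exact hcomm.eq.symm
    have ho : orderOf (⟨g * y * g⁻¹, hyc⟩ : Subgroup.centralizer {g * s * g⁻¹}) = q ^ j := by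
      rw [Subgroup.orderOf_mk, ← hj]
      exact orderOf_injective (MulAut.conj g).toMonoidHom (MulAut.conj g).injective y
    obtain ⟨⟨w, hw⟩, hwQ⟩ := exists_conj_mem_sylow_of_orderOf_eq_pow ho (Q (g * s * g⁻¹))
    refine ⟨g * s * g⁻¹, ?_, w * (g * y * g⁻¹) * w⁻¹, ⟨_, hwQ, rfl⟩, ?_⟩
    · simpa [conj_eq_one_iff] using And.intro hg hs1
    · refine IsConj.trans ?_ (ConjClasses.mk_eq_mk_iff_isConj.1 hxx')
      rw [Subgroup.mem_centralizer_singleton_iff] at hw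
      have hw' : w * (g * s * g⁻¹) * w⁻¹ = g * s * g⁻¹ := by rw [hw]; group
      refine (isConj_iff.2 ⟨w * g, ?_⟩ : IsConj (s * y) _).symm
      calc w * g * (s * y) * (w * g)⁻¹
          = (w * (g * s * g⁻¹) * w⁻¹) * (w * (g * y * g⁻¹) * w⁻¹) := by group
        _ = _ := by rw [hw']

theorem ncard_conjClasses_orderOf_eq_pow_le [Finite K] {p : ℕ} [hp : Fact p.Prime]
    (P : Sylow p K) :
    {C : ConjClasses K | ∃ x, ConjClasses.mk x = C ∧ ∃ k, orderOf x = p ^ k}.ncard ≤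
      Nat.card (ConjClasses P) := by
  rw [← Set.ncard_univ]
  refine (Set.ncard_le_ncard ?_ (Set.toFinite _)).trans
    (Set.ncard_image_le (f := ConjClasses.map (P : Subgroup K).subtype) (Set.toFinite _))
  rintro _ ⟨x, rfl, k, hk⟩
  obtain ⟨g, hg⟩ := exists_conj_mem_sylow_of_orderOf_eq_pow hk P
  refine ⟨ConjClasses.mk ⟨_, hg⟩, Set.mem_univ _, ?_⟩
  exact ConjClasses.mk_eq_mk_iff_isConj.2 (isConj_iff.2 ⟨g, rfl⟩ : IsConj x _).symm

end Classes

section Unitriangular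

/-- The entries of a `5 × 5` upper unitriangular matrix over `𝔽₂`: the first, the second, and
the remaining two superdiagonals. -/
abbrev UniCoord : Type :=
  (Bool × Bool × Bool × Bool) × (Bool × Bool × Bool) × (Bool × Bool) × Bool

namespace UniCoord

/-- The obstruction to commuting on the second superdiagonal. -/
def defect₁ (a₁ a₂ a₃ a₄ a₁' a₂' a₃' a₄' : Bool) : Bool :=
  ((a₁ && a₂') ^^ (a₁' && a₂)) || (((a₂ && a₃') ^^ (a₂' && a₃)) ||
    ((a₃ && a₄') ^^ (a₃' && a₄)))

/-- The obstruction to commuting on the third superdiagonal. -/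
def defect₂ (a₁ a₂ a₃ a₄ b₁ b₂ b₃ a₁' a₂' a₃' a₄' b₁' b₂' b₃' : Bool) : Bool :=
  (((a₁ && b₂') ^^ (b₁ && a₃')) ^^ ((a₁' && b₂) ^^ (b₁' && a₃))) ||
    (((a₂ && b₃') ^^ (b₂ && a₄')) ^^ ((a₂' && b₃) ^^ (b₂' && a₄)))

/-- The obstruction to commuting in the top right corner. -/
def defect₃ (a₁ a₄ b₁ b₃ c₁ c₂ a₁' a₄' b₁' b₃' c₁' c₂' : Bool) : Bool :=
  ((a₁ && c₂') ^^ ((b₁ && b₃') ^^ (c₁ && a₄'))) ^^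
    ((a₁' && c₂) ^^ ((b₁' && b₃) ^^ (c₁' && a₄)))

/-- The obstruction to commuting of two unitriangular matrices, in coordinates. -/
def defect : UniCoord → UniCoord → Bool
  | ((a₁, a₂, a₃, a₄), (b₁, b₂, b₃), (c₁, c₂), _),
    ((a₁', a₂', a₃', a₄'), (b₁', b₂', b₃'), (c₁', c₂'), _) =>
    defect₁ a₁ a₂ a₃ a₄ a₁' a₂' a₃' a₄' ||
      (defect₂ a₁ a₂ a₃ a₄ b₁ b₂ b₃ a₁' a₂' a₃' a₄' b₁' b₂' b₃' ||
        defect₃ a₁ a₄ b₁ b₃ c₁ c₂ a₁' a₄' b₁' b₃' c₁' c₂')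

/-- Sum over the two Booleans. -/
def boolSum (f : Bool → ℕ) : ℕ := f true + f false

theorem sum_bool_eq (f : Bool → ℕ) : ∑ b, f b = boolSum f := Fintype.sum_bool f

theorem boolSum_const (n : ℕ) : (boolSum fun _ => n) = 2 * n := (two_mul n).symm

/-- The number of unitriangular matrices commuting with a given one. -/
def centralizerCard (a₁ a₂ a₃ a₄ b₁ b₂ b₃ c₁ c₂ : Bool) : ℕ :=
  boolSum fun a₁' => boolSum fun a₂' => boolSum fun a₃' => boolSum fun a₄' =>
    bif defect₁ a₁ a₂ a₃ a₄ a₁' a₂' a₃' a₄' then 0 else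
      boolSum fun b₁' => boolSum fun b₂' => boolSum fun b₃' =>
        bif defect₂ a₁ a₂ a₃ a₄ b₁ b₂ b₃ a₁' a₂' a₃' a₄' b₁' b₂' b₃' then 0 else
          boolSum fun c₁' => boolSum fun c₂' =>
            bif defect₃ a₁ a₄ b₁ b₃ c₁ c₂ a₁' a₄' b₁' b₃' c₁' c₂' then 0 else 2

theorem card_filter_defect (a₁ a₂ a₃ a₄ b₁ b₂ b₃ c₁ c₂ d : Bool) :
    (Finset.univ.filter fun w =>
      defect ((a₁, a₂, a₃, a₄), (b₁, b₂, b₃), (c₁, c₂), d) w = false).card =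
        centralizerCard a₁ a₂ a₃ a₄ b₁ b₂ b₃ c₁ c₂ := by
  have h (p q r : Bool) : (if (p || (q || r)) = false then 1 else 0 : ℕ) =
      bif p then 0 else (bif q then 0 else (bif r then 0 else 1)) := by
    cases p <;> cases q <;> cases r <;> rfl
  have hd (a₁' a₂' a₃' a₄' b₁' b₂' b₃' c₁' c₂' d' : Bool) :
      (if defect ((a₁, a₂, a₃, a₄), (b₁, b₂, b₃), (c₁, c₂), d)
        ((a₁', a₂', a₃', a₄'), (b₁', b₂', b₃'), (c₁', c₂'), d') = false then 1 else 0 : ℕ) = _ :=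
    h (defect₁ a₁ a₂ a₃ a₄ a₁' a₂' a₃' a₄')
      (defect₂ a₁ a₂ a₃ a₄ b₁ b₂ b₃ a₁' a₂' a₃' a₄' b₁' b₂' b₃')
      (defect₃ a₁ a₄ b₁ b₃ c₁ c₂ a₁' a₄' b₁' b₃' c₁' c₂')
  have h' (p : Bool) (f : Bool → ℕ) :
      (boolSum fun b => bif p then 0 else f b) = bif p then 0 else boolSum f := by
    cases p <;> rfl
  rw [Finset.card_filter]
  simp only [Fintype.sum_prod_type, sum_bool_eq, hd, h']
  rfl

theorem sum_centralizerCard_sub :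
    ∑ v : UniCoord, ((Finset.univ.filter fun w => defect v w = false).card - 64) ≤ 17408 := by
  simp only [Fintype.sum_prod_type, card_filter_defect, sum_bool_eq, boolSum_const]
  decide +kernel

end UniCoord

end Unitriangular

section UnitriangularSubgroup

local notation "G" => Matrix.GeneralLinearGroup (Fin 5) (ZMod 2)
local notation "M" => Matrix (Fin 5) (Fin 5) (ZMod 2)

open UniCoord

/-- The monoid of upper unitriangular `5 × 5` matrices over `𝔽₂`. -/
def unitriangularSubmonoid : Submonoid G where
  carrier := {g | ∀ i j, j ≤ i → (g : M) i j = (1 : M) i j}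
  one_mem' := fun _ _ _ => rfl
  mul_mem' := by
    intro g h hg hh i j hij
    rw [Units.val_mul, Matrix.mul_apply, Finset.sum_eq_single i]
    · rw [hg i i le_rfl, hh i j hij, Matrix.one_apply_eq, one_mul]
    · intro k _ hk
      rcases lt_or_gt_of_ne hk with hk' | hk'
      · rw [hg i k hk'.le, Matrix.one_apply_ne hk.symm, zero_mul]
      · have hkj : j < k := hij.trans_lt hk'
        rw [hh k j hkj.le, Matrix.one_apply_ne hkj.ne', mul_zero]
    · simp

/-- The group of upper unitriangular `5 × 5` matrices over `𝔽₂`. -/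
def unitriangular : Subgroup G where
  toSubmonoid := unitriangularSubmonoid
  inv_mem' := by
    intro g hg
    obtain ⟨n, hn⟩ := mem_powers_iff_mem_zpowers.2 (inv_mem (Subgroup.mem_zpowers g))
    rw [← hn]
    exact pow_mem (S := unitriangularSubmonoid) hg n

/-- The superdiagonal entries of a matrix. -/
def uniCoord (g : G) : UniCoord :=
  let e : Fin 5 → Fin 5 → Bool := fun i j => decide ((g : M) i j = 1)
  ((e 0 1, e 1 2, e 2 3, e 3 4), (e 0 2, e 1 3, e 2 4), (e 0 3, e 1 4), e 0 4)

theorem decide_eq_one_inj {x y : ZMod 2} : decide (x = 1) = decide (y = 1) → x = y := by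
  revert x y; decide

theorem decide_mul_eq_one (x y : ZMod 2) :
    decide (x * y = 1) = (decide (x = 1) && decide (y = 1)) := by
  revert x y; decide

theorem decide_add_eq_one (x y : ZMod 2) :
    decide (x + y = 1) = (decide (x = 1) ^^ decide (y = 1)) := by
  revert x y; decide

theorem unitriangular_entries {g : G} (hg : g ∈ unitriangular) :
    (g : M) = !![1, g 0 1, g 0 2, g 0 3, g 0 4; 0, 1, g 1 2, g 1 3, g 1 4;
      0, 0, 1, g 2 3, g 2 4; 0, 0, 0, 1, g 3 4; 0, 0, 0, 0, 1] := by
  ext i j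
  by_cases hij : j ≤ i
  · rw [hg i j hij]
    fin_cases i <;> fin_cases j <;> first | rfl | exact absurd hij (by decide)
  · fin_cases i <;> fin_cases j <;> first | rfl | exact absurd (by decide) hij

theorem uniCoord_injOn : Set.InjOn uniCoord (unitriangular : Set G) := by
  intro g hg h hh hgh
  simp only [uniCoord, Prod.mk.injEq] at hgh
  obtain ⟨⟨h1, h2, h3, h4⟩, ⟨h5, h6, h7⟩, ⟨h8, h9⟩, h10⟩ := hgh
  apply Units.ext
  rw [unitriangular_entries hg, unitriangular_entries hh, decide_eq_one_inj h1,
    decide_eq_one_inj h2, decide_eq_one_inj h3, decide_eq_one_inj h4, decide_eq_one_inj h5,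
    decide_eq_one_inj h6, decide_eq_one_inj h7, decide_eq_one_inj h8, decide_eq_one_inj h9,
    decide_eq_one_inj h10]

theorem uniCoord_surjOn (v : UniCoord) : ∃ g ∈ unitriangular, uniCoord g = v := by
  obtain ⟨⟨a₁, a₂, a₃, a₄⟩, ⟨b₁, b₂, b₃⟩, ⟨c₁, c₂⟩, d⟩ := v
  let γ : Bool → ZMod 2 := fun b => bif b then 1 else 0
  have hγ : ∀ b, decide (γ b = 1) = b := by decide
  let A : M := !![1, γ a₁, γ b₁, γ c₁, γ d; 0, 1, γ a₂, γ b₂, γ c₂;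
      0, 0, 1, γ a₃, γ b₃; 0, 0, 0, 1, γ a₄; 0, 0, 0, 0, 1]
  have hA : A.BlockTriangular id := by
    intro i j hij
    fin_cases i <;> fin_cases j <;> first | rfl | exact absurd hij (by decide)
  have hdet : A.det ≠ 0 := by
    rw [Matrix.det_of_isUpperTriangular hA]
    simp [Fin.prod_univ_five, A]
  refine ⟨Matrix.GeneralLinearGroup.mkOfDetNeZero A hdet, ?_, ?_⟩
  · intro i j hij
    change A i j = _
    fin_cases i <;> fin_cases j <;> first | rfl | exact absurd hij (by decide)
  · change ((decide (γ a₁ = 1), decide (γ a₂ = 1), decide (γ a₃ = 1), decide (γ a₄ = 1)),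
      (decide (γ b₁ = 1), decide (γ b₂ = 1), decide (γ b₃ = 1)),
      (decide (γ c₁ = 1), decide (γ c₂ = 1)), decide (γ d = 1)) = _
    simp only [hγ]

theorem card_unitriangular : Nat.card unitriangular = 2 ^ 10 := by
  have h : Function.Bijective fun g : unitriangular => uniCoord g :=
    ⟨fun g h hgh => Subtype.ext (uniCoord_injOn g.2 h.2 hgh), fun v => by
      obtain ⟨g, hg, rfl⟩ := uniCoord_surjOn v
      exact ⟨⟨g, hg⟩, rfl⟩⟩
  rw [Nat.card_congr (Equiv.ofBijective _ h), Nat.card_eq_fintype_card]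
  simp

theorem defect_eq_false_of_commute {g h : G} (hg : g ∈ unitriangular) (hh : h ∈ unitriangular)
    (hgh : Commute g h) : defect (uniCoord g) (uniCoord h) = false := by
  have hc : (g : M) * h = h * g := congrArg Units.val hgh.eq
  have e (i j : Fin 5) : ((g : M) * h) i j = ((h : M) * g) i j := by rw [hc]
  have e02 := e 0 2
  have e13 := e 1 3
  have e24 := e 2 4
  have e03 := e 0 3
  have e14 := e 1 4
  have e04 := e 0 4
  rw [unitriangular_entries hg, unitriangular_entries hh] at e02 e13 e24 e03 e14 e04
  simp [Matrix.mul_apply, Fin.sum_univ_five] at e02 e13 e24 e03 e14 e04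
  have f02 : g 0 1 * h 1 2 = h 0 1 * g 1 2 := by linear_combination e02
  have f13 : g 1 2 * h 2 3 = h 1 2 * g 2 3 := by linear_combination e13
  have f24 : g 2 3 * h 3 4 = h 2 3 * g 3 4 := by linear_combination e24
  have f03 : g 0 1 * h 1 3 + g 0 2 * h 2 3 = h 0 1 * g 1 3 + h 0 2 * g 2 3 := by
    linear_combination e03
  have f14 : g 1 2 * h 2 4 + g 1 3 * h 3 4 = h 1 2 * g 2 4 + h 1 3 * g 3 4 := by
    linear_combination e14
  have f04 : g 0 1 * h 1 4 + (g 0 2 * h 2 4 + g 0 3 * h 3 4) =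
      h 0 1 * g 1 4 + (h 0 2 * g 2 4 + h 0 3 * g 3 4) := by
    linear_combination e04
  replace f02 := congrArg (fun x => decide (x = 1)) f02
  replace f13 := congrArg (fun x => decide (x = 1)) f13
  replace f24 := congrArg (fun x => decide (x = 1)) f24
  replace f03 := congrArg (fun x => decide (x = 1)) f03
  replace f14 := congrArg (fun x => decide (x = 1)) f14
  replace f04 := congrArg (fun x => decide (x = 1)) f04
  simp only [decide_add_eq_one, decide_mul_eq_one] at f02 f13 f24 f03 f14 f04
  simp only [uniCoord, defect, defect₁, defect₂, defect₃]
  rw [f02, f13, f24, f03, f14, f04]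
  simp only [Bool.xor_self, Bool.or_self]

theorem card_conjClasses_mul_card_le {P : Type*} [Group P] [Finite P] {ψ : P →* G}
    (hψ : Function.Injective ψ) (hU : ∀ x, ψ x ∈ unitriangular) :
    Nat.card (ConjClasses P) * Nat.card P ≤ 64 * Nat.card P + 17408 := by
  classical
  have := Fintype.ofFinite P
  have hinj : Function.Injective fun x => uniCoord (ψ x) :=
    fun x y hxy => hψ (uniCoord_injOn (hU x) (hU y) hxy)
  let n : UniCoord → ℕ := fun v => (Finset.univ.filter fun w => defect v w = false).card
  have hn (x : P) : (Finset.univ.filter fun y => Commute x y).card ≤ n (uniCoord (ψ x)) := by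
    refine Finset.card_le_card_of_injOn (fun y => uniCoord (ψ y)) ?_ hinj.injOn
    intro y hy
    have hy' : Commute x y := by simpa using hy
    simpa using defect_eq_false_of_commute (hU x) (hU y) (hy'.map ψ)
  have hcard : Nat.card {p : P × P // Commute p.1 p.2} =
      ∑ x : P, (Finset.univ.filter fun y => Commute x y).card := by
    rw [Nat.card_eq_fintype_card, Fintype.card_subtype]
    simp only [Finset.card_filter, Fintype.sum_prod_type]
  rw [← card_comm_eq_card_conjClasses_mul_card, hcard]
  calc ∑ x : P, (Finset.univ.filter fun y => Commute x y).card
      ≤ ∑ x : P, (64 + (n (uniCoord (ψ x)) - 64)) :=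
        Finset.sum_le_sum fun x _ => (hn x).trans (by omega)
    _ = 64 * Nat.card P + ∑ x : P, (n (uniCoord (ψ x)) - 64) := by
        rw [Finset.sum_add_distrib, Finset.sum_const, Finset.card_univ,
          Nat.card_eq_fintype_card, smul_eq_mul, mul_comm]
    _ ≤ 64 * Nat.card P + ∑ v : UniCoord, (n v - 64) := by
        refine Nat.add_le_add_left ?_ _
        rw [← Finset.sum_image (s := Finset.univ) (g := fun x => uniCoord (ψ x))
          (f := fun v => n v - 64) hinj.injOn]
        exact Finset.sum_le_sum_of_subset (Finset.subset_univ _)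
    _ ≤ 64 * Nat.card P + 17408 := Nat.add_le_add_left sum_centralizerCard_sub _

end UnitriangularSubgroup

section Centralizers

local notation "G" => Matrix.GeneralLinearGroup (Fin 5) (ZMod 2)
local notation "M" => Matrix (Fin 5) (Fin 5) (ZMod 2)
local notation "V" => Fin 5 → ZMod 2
local notation "e" j => (Pi.single j 1 : Fin 5 → ZMod 2)

open Matrix

theorem card_centralizer_dvd_conj {K : Type*} [Group K] [Finite K] (g s : K) :
    Nat.card (Subgroup.centralizer {s}) ∣ Nat.card (Subgroup.centralizer {g * s * g⁻¹}) := by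
  have h (y : Subgroup.centralizer {s}) :
      ((MulAut.conj g).toMonoidHom.comp (Subgroup.centralizer {s}).subtype) y ∈
        Subgroup.centralizer {g * s * g⁻¹} := by
    rw [Subgroup.mem_centralizer_singleton_iff]
    have hy := Subgroup.mem_centralizer_singleton_iff.1 y.2
    have : Commute (y : K) s := hy
    exact (this.map (MulAut.conj g)).eq
  refine Subgroup.card_dvd_of_injective (MonoidHom.codRestrict _ _ h) ?_
  intro x y hxy
  exact Subtype.ext ((MulAut.conj g).injective (congrArg Subtype.val hxy))

theorem card_centralizer_conj {K : Type*} [Group K] [Finite K] (g s : K) :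
    Nat.card (Subgroup.centralizer {g * s * g⁻¹}) = Nat.card (Subgroup.centralizer {s}) := by
  refine Nat.dvd_antisymm ?_ (card_centralizer_dvd_conj g s)
  have h := card_centralizer_dvd_conj g⁻¹ (g * s * g⁻¹)
  rwa [show g⁻¹ * (g * s * g⁻¹) * g⁻¹⁻¹ = s by group] at h

theorem centralizer_singleton_inv {K : Type*} [Group K] (s : K) :
    Subgroup.centralizer {s⁻¹} = Subgroup.centralizer {s} := by
  ext y
  simp only [Subgroup.mem_centralizer_singleton_iff]
  exact (Commute.inv_right_iff : Commute y s⁻¹ ↔ Commute y s)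

theorem card_centralizer_coe_dvd {K : Type*} [Group K] [Finite K] (H : Subgroup K) (s : H) :
    Nat.card (Subgroup.centralizer {s}) ∣ Nat.card (Subgroup.centralizer {(s : K)}) := by
  have h (y : Subgroup.centralizer {s}) :
      (H.subtype.comp (Subgroup.centralizer {s}).subtype) y ∈
        Subgroup.centralizer {(s : K)} := by
    rw [Subgroup.mem_centralizer_singleton_iff]
    exact congrArg Subtype.val (Subgroup.mem_centralizer_singleton_iff.1 y.2)
  refine Subgroup.card_dvd_of_injective (MonoidHom.codRestrict _ _ h) ?_
  intro x y hxy
  exact Subtype.ext (Subtype.ext (congrArg (fun z : Subgroup.centralizer {(s : K)} => (z : K)) hxy))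

/-- If `p` divides the order of `K` exactly once, centralizers of nontrivial `p`-elements are no
larger than the centralizer of a given element of order `p`. -/
theorem card_centralizer_le_of_factorization_eq_one {K : Type*} [Group K] [Finite K] {p k : ℕ}
    [hp : Fact p.Prime] (hK : (Nat.card K).factorization p = 1) {r s : K} (hr : orderOf r = p)
    (hs : orderOf s = p ^ k) (hs1 : s ≠ 1) :
    Nat.card (Subgroup.centralizer {s}) ≤ Nat.card (Subgroup.centralizer {r}) := by
  have hcard : Nat.card (Subgroup.zpowers r) = p := by rw [Nat.card_zpowers, hr]
  obtain ⟨g, hg⟩ := exists_conj_mem_sylow_of_orderOf_eq_pow hs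
    (Sylow.ofCard (Subgroup.zpowers r) (by rw [hcard, hK, pow_one]))
  have hg' : g * s * g⁻¹ ∈ Subgroup.zpowers r := hg
  rw [← card_centralizer_conj g s]
  refine Subgroup.card_le_of_le fun y hy => ?_
  rw [Subgroup.mem_centralizer_singleton_iff] at hy ⊢
  have hne : (⟨g * s * g⁻¹, hg'⟩ : Subgroup.zpowers r) ≠ 1 := by
    simpa [Subtype.ext_iff, conj_eq_one_iff] using hs1
  obtain ⟨i, hi⟩ := mem_zpowers_of_prime_card (g' := ⟨r, Subgroup.mem_zpowers r⟩) hcard hne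
  have hi' : (g * s * g⁻¹) ^ i = r := congrArg Subtype.val hi
  rw [← hi']
  exact (Commute.zpow_right (show Commute y (g * s * g⁻¹) from hy) i).eq

/-- The nonzero vectors in the kernel of a matrix. -/
def kerNonzero (N : M) : Finset V := Finset.univ.filter fun v => N *ᵥ v = 0 ∧ v ≠ 0

theorem GL_mulVec_injective (x : G) : Function.Injective fun v : V => (x : M) *ᵥ v :=
  Matrix.mulVec_injective_of_isUnit x.isUnit

theorem mulVec_mem_kerNonzero {x : G} {N : M} (h : Commute (x : M) N) {v : V}
    (hv : v ∈ kerNonzero N) : (x : M) *ᵥ v ∈ kerNonzero N := by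
  simp only [kerNonzero, Finset.mem_filter, Finset.mem_univ, true_and] at hv ⊢
  refine ⟨?_, fun h0 => hv.2 (GL_mulVec_injective x (by simpa using h0))⟩
  rw [mulVec_mulVec, ← h.eq, ← mulVec_mulVec, hv.1, mulVec_zero]

theorem mulVec_eq_of_commute {x y r : M} (hx : Commute x r) (hy : Commute y r) {v w : V}
    (h : x *ᵥ v = y *ᵥ v) (hw : r *ᵥ v = w) : x *ᵥ w = y *ᵥ w := by
  rw [← hw, mulVec_mulVec, mulVec_mulVec, hx.eq, hy.eq, ← mulVec_mulVec, ← mulVec_mulVec, h]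

theorem GL_ext_single {x y : G} (h : ∀ j, (x : M) *ᵥ (e j) = (y : M) *ᵥ (e j)) : x = y := by
  apply Units.ext
  ext i j
  simpa using congrFun (h j) i

theorem commute_of_mem_centralizer {r x : G} (hx : x ∈ Subgroup.centralizer {r}) :
    Commute (x : M) (r : M) :=
  congrArg Units.val (Subgroup.mem_centralizer_singleton_iff.1 hx)

/-- A Singer cycle. -/
def elt31 : G :=
  ⟨!![0, 0, 0, 0, 1; 1, 0, 0, 0, 0; 0, 1, 0, 0, 1; 0, 0, 1, 0, 0; 0, 0, 0, 1, 0],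
    !![0, 1, 0, 0, 0; 1, 0, 1, 0, 0; 0, 0, 0, 1, 0; 0, 0, 0, 0, 1; 1, 0, 0, 0, 0],
    by decide, by decide⟩

/-- An element of order `5`. -/
def elt5 : G :=
  ⟨!![0, 0, 0, 1, 0; 1, 0, 0, 1, 0; 0, 1, 0, 1, 0; 0, 0, 1, 1, 0; 0, 0, 0, 0, 1],
    !![1, 1, 0, 0, 0; 1, 0, 1, 0, 0; 1, 0, 0, 1, 0; 1, 0, 0, 0, 0; 0, 0, 0, 0, 1],
    by decide, by decide⟩

/-- An element of order `7`. -/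
def elt7 : G :=
  ⟨!![0, 0, 1, 0, 0; 1, 0, 1, 0, 0; 0, 1, 0, 0, 0; 0, 0, 0, 1, 0; 0, 0, 0, 0, 1],
    !![1, 1, 0, 0, 0; 0, 0, 1, 0, 0; 1, 0, 0, 0, 0; 0, 0, 0, 1, 0; 0, 0, 0, 0, 1],
    by decide, by decide⟩

/-- An element of order `3` acting on the first two coordinates. -/
def elt3 : G :=
  ⟨!![0, 1, 0, 0, 0; 1, 1, 0, 0, 0; 0, 0, 1, 0, 0; 0, 0, 0, 1, 0; 0, 0, 0, 0, 1],
    !![1, 1, 0, 0, 0; 1, 0, 0, 0, 0; 0, 0, 1, 0, 0; 0, 0, 0, 1, 0; 0, 0, 0, 0, 1],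
    by decide, by decide⟩

/-- An element of order `3` acting on the third and fourth coordinates. -/
def elt3Right : G :=
  ⟨!![1, 0, 0, 0, 0; 0, 1, 0, 0, 0; 0, 0, 0, 1, 0; 0, 0, 1, 1, 0; 0, 0, 0, 0, 1],
    !![1, 0, 0, 0, 0; 0, 1, 0, 0, 0; 0, 0, 1, 1, 0; 0, 0, 1, 0, 0; 0, 0, 0, 0, 1],
    by decide, by decide⟩

/-- An element of order `7` commuting with `elt3`. -/
def elt7Right : G :=
  ⟨!![1, 0, 0, 0, 0; 0, 1, 0, 0, 0; 0, 0, 0, 0, 1; 0, 0, 1, 0, 1; 0, 0, 0, 1, 0],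
    !![1, 0, 0, 0, 0; 0, 1, 0, 0, 0; 0, 0, 1, 1, 0; 0, 0, 0, 0, 1; 0, 0, 1, 0, 0],
    by decide, by decide⟩

/-- An element of order `5` commuting with `elt3 * elt3Right`. -/
def elt5Right : G :=
  ⟨!![0, 0, 1, 0, 0; 0, 0, 0, 1, 0; 1, 0, 0, 1, 0; 0, 1, 1, 1, 0; 0, 0, 0, 0, 1],
    !![0, 1, 1, 0, 0; 1, 1, 0, 1, 0; 1, 0, 0, 0, 0; 0, 1, 0, 0, 0; 0, 0, 0, 0, 1],
    by decide, by decide⟩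

theorem orderOf_eq_prime_of_val_pow {p : ℕ} (hp : p.Prime) {x : G} (hx : (x : M) ^ p = 1)
    (hx1 : (x : M) ≠ 1) : orderOf x = p := by
  have : Fact p.Prime := ⟨hp⟩
  refine orderOf_eq_prime (Units.ext ?_) fun h => hx1 (by rw [h, Units.val_one])
  rw [Units.val_pow_eq_pow_val, hx, Units.val_one]

theorem orderOf_elt31 : orderOf elt31 = 31 := by
  refine orderOf_eq_prime_of_val_pow (by norm_num) ?_ (by decide +kernel)
  have h4 : (elt31 : M) ^ 4 =
      !![0, 1, 0, 0, 1; 0, 0, 1, 0, 0; 0, 1, 0, 1, 1; 0, 0, 1, 0, 1; 1, 0, 0, 1, 0] := by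
    decide +kernel
  have h16 : (elt31 : M) ^ 16 =
      !![1, 1, 1, 0, 0; 1, 1, 1, 1, 0; 0, 0, 0, 1, 1; 1, 0, 0, 0, 1; 1, 1, 0, 0, 0] := by
    rw [show 16 = 4 * 4 from rfl, pow_mul, h4]
    decide +kernel
  rw [show 31 = 16 + 4 * 3 + 3 from rfl, pow_add, pow_add, pow_mul, h4, h16]
  decide +kernel

theorem orderOf_elt5 : orderOf elt5 = 5 :=
  orderOf_eq_prime_of_val_pow (by norm_num) (by decide +kernel) (by decide +kernel)

theorem orderOf_elt5Right : orderOf elt5Right = 5 :=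
  orderOf_eq_prime_of_val_pow (by norm_num) (by decide +kernel) (by decide +kernel)

theorem orderOf_elt3 : orderOf elt3 = 3 :=
  orderOf_eq_prime_of_val_pow (by norm_num) (by decide +kernel) (by decide +kernel)

theorem orderOf_elt3Right : orderOf elt3Right = 3 :=
  orderOf_eq_prime_of_val_pow (by norm_num) (by decide +kernel) (by decide +kernel)

theorem orderOf_elt7 : orderOf elt7 = 7 := by
  refine orderOf_eq_prime_of_val_pow (by norm_num) ?_ (by decide +kernel)
  have h4 : (elt7 : M) ^ 4 =
      !![0, 1, 1, 0, 0; 1, 1, 0, 0, 0; 1, 1, 1, 0, 0; 0, 0, 0, 1, 0; 0, 0, 0, 0, 1] := by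
    decide +kernel
  rw [show 7 = 4 + 3 from rfl, pow_add, h4]
  decide +kernel

theorem orderOf_elt7Right : orderOf elt7Right = 7 := by
  refine orderOf_eq_prime_of_val_pow (by norm_num) ?_ (by decide +kernel)
  have h4 : (elt7Right : M) ^ 4 =
      !![1, 0, 0, 0, 0; 0, 1, 0, 0, 0; 0, 0, 0, 1, 1; 0, 0, 1, 1, 0; 0, 0, 1, 1, 1] := by
    decide +kernel
  rw [show 7 = 4 + 3 from rfl, pow_add, h4]
  decide +kernel

theorem card_centralizer_le_card {α : Type*} {r : G} (F : Finset α) (f : G → α)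
    (hf : ∀ x : G, Commute (x : M) (r : M) → f x ∈ F)
    (hinj : ∀ x y : G, Commute (x : M) (r : M) → Commute (y : M) (r : M) → f x = f y →
      ∀ j, (x : M) *ᵥ (e j) = (y : M) *ᵥ (e j)) :
    Nat.card (Subgroup.centralizer {r}) ≤ F.card := by
  rw [← Nat.card_eq_finsetCard F]
  refine Nat.card_le_card_of_injective
    (fun x => ⟨f x, hf x (commute_of_mem_centralizer x.2)⟩) fun x y hxy => ?_
  exact Subtype.ext (GL_ext_single (hinj x y (commute_of_mem_centralizer x.2)
    (commute_of_mem_centralizer y.2) (Subtype.ext_iff.1 hxy)))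

theorem card_centralizer_elt31 : Nat.card (Subgroup.centralizer {elt31}) ≤ 31 := by
  have hk : (kerNonzero 0).card = 31 := by decide +kernel
  refine (card_centralizer_le_card (kerNonzero 0) (fun x => (x : M) *ᵥ (e 0)) ?_ ?_).trans_eq hk
  · exact fun x _ => mulVec_mem_kerNonzero (Commute.zero_right _) (by decide +kernel)
  · intro x y hx hy h0
    have h1 := mulVec_eq_of_commute (w := e 1) hx hy h0 (by decide +kernel)
    have h2 := mulVec_eq_of_commute (w := e 2) hx hy h1 (by decide +kernel)
    have h3 := mulVec_eq_of_commute (w := e 3) hx hy h2 (by decide +kernel)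
    have h4 := mulVec_eq_of_commute (w := e 4) hx hy h3 (by decide +kernel)
    exact fun j => by fin_cases j <;> assumption

theorem card_centralizer_elt5 : Nat.card (Subgroup.centralizer {elt5}) ≤ 15 := by
  let r : M := elt5
  let F := kerNonzero (1 + r * (1 + r * (1 + r * (1 + r)))) ×ˢ kerNonzero (1 + r)
  have hk : F.card = 15 := by rw [Finset.card_product]; decide +kernel
  refine (card_centralizer_le_card F
    (fun x => ((x : M) *ᵥ (e 0), (x : M) *ᵥ (e 4))) ?_ ?_).trans_eq hk
  · intro x (hx : Commute (x : M) r)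
    have h1 : Commute (x : M) 1 := Commute.one_right _
    have h2 := h1.add_right hx
    have h3 := h1.add_right (hx.mul_right (h1.add_right (hx.mul_right
      (h1.add_right (hx.mul_right h2)))))
    simp only [F, Finset.mem_product]
    exact ⟨mulVec_mem_kerNonzero h3 (by decide +kernel),
      mulVec_mem_kerNonzero h2 (by decide +kernel)⟩
  · intro x y hx hy h
    obtain ⟨h0, h4⟩ := Prod.mk.inj h
    have h1 := mulVec_eq_of_commute (w := e 1) hx hy h0 (by decide +kernel)
    have h2 := mulVec_eq_of_commute (w := e 2) hx hy h1 (by decide +kernel)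
    have h3 := mulVec_eq_of_commute (w := e 3) hx hy h2 (by decide +kernel)
    exact fun j => by fin_cases j <;> assumption

theorem card_centralizer_elt7 : Nat.card (Subgroup.centralizer {elt7}) ≤ 42 := by
  let r : M := elt7
  let F := kerNonzero (1 + r + r * (r * r)) ×ˢ (kerNonzero (1 + r)).offDiag
  have hk : F.card = 42 := by
    rw [Finset.card_product, Finset.offDiag_card]
    decide +kernel
  refine (card_centralizer_le_card F
    (fun x => ((x : M) *ᵥ (e 0), (x : M) *ᵥ (e 3), (x : M) *ᵥ (e 4))) ?_ ?_).trans_eq hk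
  · intro x (hx : Commute (x : M) r)
    have h1 : Commute (x : M) 1 := Commute.one_right _
    have h2 := h1.add_right hx
    have h3 := h2.add_right (hx.mul_right (hx.mul_right hx))
    simp only [F, Finset.mem_product, Finset.mem_offDiag]
    exact ⟨mulVec_mem_kerNonzero h3 (by decide +kernel),
      mulVec_mem_kerNonzero h2 (by decide +kernel),
      mulVec_mem_kerNonzero h2 (by decide +kernel), (GL_mulVec_injective x).ne (by decide)⟩
  · intro x y hx hy h
    obtain ⟨h0, h'⟩ := Prod.mk.inj h
    obtain ⟨h3, h4⟩ := Prod.mk.inj h'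
    have h1 := mulVec_eq_of_commute (w := e 1) hx hy h0 (by decide +kernel)
    have h2 := mulVec_eq_of_commute (w := e 2) hx hy h1 (by decide +kernel)
    exact fun j => by fin_cases j <;> assumption

theorem card_centralizer_elt3 : Nat.card (Subgroup.centralizer {elt3}) ≤ 882 := by
  let r : M := elt3
  let F := kerNonzero (1 + r + r * r) ×ˢ (kerNonzero (1 + r)).offDiag ×ˢ kerNonzero (1 + r)
  have hk : F.card = 882 := by
    rw [Finset.card_product, Finset.card_product, Finset.offDiag_card]
    decide +kernel
  refine (card_centralizer_le_card F (fun x => ((x : M) *ᵥ (e 0),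
    ((x : M) *ᵥ (e 2), (x : M) *ᵥ (e 3)), (x : M) *ᵥ (e 4))) ?_ ?_).trans_eq hk
  · intro x (hx : Commute (x : M) r)
    have h1 : Commute (x : M) 1 := Commute.one_right _
    have h2 := h1.add_right hx
    have h3 := h2.add_right (hx.mul_right hx)
    simp only [F, Finset.mem_product, Finset.mem_offDiag]
    exact ⟨mulVec_mem_kerNonzero h3 (by decide +kernel),
      ⟨mulVec_mem_kerNonzero h2 (by decide +kernel),
        mulVec_mem_kerNonzero h2 (by decide +kernel), (GL_mulVec_injective x).ne (by decide)⟩,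
      mulVec_mem_kerNonzero h2 (by decide +kernel)⟩
  · intro x y hx hy h
    obtain ⟨h0, h'⟩ := Prod.mk.inj h
    obtain ⟨h'', h4⟩ := Prod.mk.inj h'
    obtain ⟨h2, h3⟩ := Prod.mk.inj h''
    have h1 := mulVec_eq_of_commute (w := e 1) hx hy h0 (by decide +kernel)
    exact fun j => by fin_cases j <;> assumption

theorem card_centralizer_elt3_mul_elt3Right :
    Nat.card (Subgroup.centralizer {elt3 * elt3Right}) ≤ 225 := by
  let r : M := (elt3 * elt3Right : G)
  let F := kerNonzero (1 + r + r * r) ×ˢ kerNonzero (1 + r + r * r) ×ˢ kerNonzero (1 + r)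
  have hk : F.card = 225 := by
    rw [Finset.card_product, Finset.card_product]
    decide +kernel
  refine (card_centralizer_le_card F (fun x => ((x : M) *ᵥ (e 0),
    (x : M) *ᵥ (e 2), (x : M) *ᵥ (e 4))) ?_ ?_).trans_eq hk
  · intro x (hx : Commute (x : M) r)
    have h1 : Commute (x : M) 1 := Commute.one_right _
    have h2 := h1.add_right hx
    have h3 := h2.add_right (hx.mul_right hx)
    simp only [F, Finset.mem_product]
    exact ⟨mulVec_mem_kerNonzero h3 (by decide +kernel),
      mulVec_mem_kerNonzero h3 (by decide +kernel), mulVec_mem_kerNonzero h2 (by decide +kernel)⟩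
  · intro x y hx hy h
    obtain ⟨h0, h'⟩ := Prod.mk.inj h
    obtain ⟨h2, h4⟩ := Prod.mk.inj h'
    have h1 := mulVec_eq_of_commute (w := e 1) hx hy h0 (by decide +kernel)
    have h3 := mulVec_eq_of_commute (w := e 3) hx hy h2 (by decide +kernel)
    exact fun j => by fin_cases j <;> assumption

end Centralizers

section Torus

local notation "G" => Matrix.GeneralLinearGroup (Fin 5) (ZMod 2)
local notation "M" => Matrix (Fin 5) (Fin 5) (ZMod 2)

theorem commute_elt3_elt3Right : Commute elt3 elt3Right := Units.ext (by decide +kernel)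

theorem commute_of_mem_zpowers (u : Subgroup.zpowers elt3) (v : Subgroup.zpowers elt3Right) :
    Commute ((Subgroup.zpowers elt3).subtype u) ((Subgroup.zpowers elt3Right).subtype v) := by
  obtain ⟨u, i, rfl⟩ := u
  obtain ⟨v, j, rfl⟩ := v
  exact commute_elt3_elt3Right.zpow_zpow i j

/-- A Sylow `3`-subgroup of `GL(5, F₂)`. -/
def torus : Subgroup G :=
  (MonoidHom.noncommCoprod (Subgroup.zpowers elt3).subtype (Subgroup.zpowers elt3Right).subtype
    commute_of_mem_zpowers).range

theorem exists_fin_pow_eq {K : Type*} [Group K] [Finite K] {n : ℕ} {r u : K} (hr : orderOf r = n)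
    (hu : u ∈ Subgroup.zpowers r) : ∃ i : Fin n, r ^ (i : ℕ) = u := by
  classical
  rw [mem_zpowers_iff_mem_range_orderOf, hr] at hu
  obtain ⟨i, hi, rfl⟩ := Finset.mem_image.1 hu
  exact ⟨⟨i, Finset.mem_range.1 hi⟩, rfl⟩

theorem exists_eq_of_mem_torus {x : G} (hx : x ∈ torus) :
    ∃ c : Fin 3 × Fin 3, x = elt3 ^ (c.1 : ℕ) * elt3Right ^ (c.2 : ℕ) := by
  obtain ⟨⟨u, v⟩, rfl⟩ := hx
  obtain ⟨i, hi⟩ := exists_fin_pow_eq orderOf_elt3 u.2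
  obtain ⟨j, hj⟩ := exists_fin_pow_eq orderOf_elt3Right v.2
  exact ⟨(i, j), by rw [hi, hj]; rfl⟩

theorem card_torus : Nat.card torus = 3 ^ 2 := by
  have hinj := (MonoidHom.noncommCoprod_injective (Subgroup.zpowers elt3).subtype
    (Subgroup.zpowers elt3Right).subtype commute_of_mem_zpowers).2
      ⟨Subtype.val_injective, Subtype.val_injective, by
        rw [Subgroup.range_subtype, Subgroup.range_subtype, Subgroup.disjoint_def]
        intro x hx hy
        obtain ⟨i, hi⟩ := exists_fin_pow_eq orderOf_elt3 hx
        obtain ⟨j, rfl⟩ := exists_fin_pow_eq orderOf_elt3Right hy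
        have key : ∀ i j : Fin 3, (elt3 : M) ^ (i : ℕ) = (elt3Right : M) ^ (j : ℕ) → j = 0 := by
          decide +kernel
        rw [key i j (by simpa using congrArg Units.val hi)]
        simp⟩
  rw [torus, ← Nat.card_congr (MonoidHom.ofInjective hinj).toEquiv, Nat.card_prod,
    Nat.card_zpowers, Nat.card_zpowers, orderOf_elt3, orderOf_elt3Right, sq]

theorem torus_le_centralizer {r : G} (h1 : Commute elt3 r) (h2 : Commute elt3Right r) :
    torus ≤ Subgroup.centralizer {r} := by
  intro x hx
  obtain ⟨c, rfl⟩ := exists_eq_of_mem_torus hx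
  rw [Subgroup.mem_centralizer_singleton_iff]
  exact ((h1.pow_left _).mul_left (h2.pow_left _)).eq

/-- The order of a Sylow `2`-subgroup of the centralizer of `s`. -/
noncomputable def centralizerTwoPart {K : Type*} [Group K] (s : K) : ℕ :=
  2 ^ (Nat.card (Subgroup.centralizer {s})).factorization 2

theorem centralizerTwoPart_conj {K : Type*} [Group K] [Finite K] (g s : K) :
    centralizerTwoPart (g * s * g⁻¹) = centralizerTwoPart s := by
  rw [centralizerTwoPart, card_centralizer_conj, centralizerTwoPart]

theorem centralizerTwoPart_inv {K : Type*} [Group K] (s : K) :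
    centralizerTwoPart s⁻¹ = centralizerTwoPart s := by
  rw [centralizerTwoPart, centralizer_singleton_inv, centralizerTwoPart]

theorem two_pow_factorization_le {n q k : ℕ} (hn : n ≠ 0) (hq : q.Coprime 2) (hqn : q ∣ n)
    (hlt : n < q * 2 ^ (k + 1)) : 2 ^ n.factorization 2 ≤ 2 ^ k := by
  have hdvd : q * 2 ^ n.factorization 2 ∣ n :=
    (hq.pow_right _).mul_dvd_of_dvd_of_dvd hqn (Nat.ordProj_dvd n 2)
  have h := (Nat.le_of_dvd (Nat.pos_of_ne_zero hn) hdvd).trans_lt hlt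
  exact Nat.pow_le_pow_right two_pos (Nat.lt_succ_iff.1
    ((Nat.pow_lt_pow_iff_right one_lt_two).1 (Nat.lt_of_mul_lt_mul_left h)))

theorem mul_nine_dvd_card_centralizer {r y : G} {p : ℕ} (h1 : Commute elt3 r)
    (h2 : Commute elt3Right r) (hy : Commute y r) (hp : orderOf y = p) (hco : p.Coprime (3 ^ 2)) :
    p * 3 ^ 2 ∣ Nat.card (Subgroup.centralizer {r}) := by
  refine hco.mul_dvd_of_dvd_of_dvd ?_ ?_
  · rw [← hp, ← Subgroup.orderOf_mk y (Subgroup.mem_centralizer_singleton_iff.2 hy.eq)]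
    exact orderOf_dvd_natCard _
  · rw [← card_torus]
    exact Subgroup.card_dvd_of_le (torus_le_centralizer h1 h2)

theorem centralizerTwoPart_elt3 : centralizerTwoPart elt3 ≤ 8 := by
  refine two_pow_factorization_le (q := 7 * 3 ^ 2) (k := 3) Nat.card_pos.ne' (by norm_num) ?_
    (card_centralizer_elt3.trans_lt (by norm_num))
  exact mul_nine_dvd_card_centralizer (Commute.refl _) commute_elt3_elt3Right.symm
    (Units.ext (by decide +kernel)) orderOf_elt7Right (by norm_num)

theorem centralizerTwoPart_elt3_mul_elt3Right : centralizerTwoPart (elt3 * elt3Right) ≤ 4 := by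
  refine two_pow_factorization_le (q := 5 * 3 ^ 2) (k := 2) Nat.card_pos.ne' (by norm_num) ?_
    (card_centralizer_elt3_mul_elt3Right.trans_lt (by norm_num))
  exact mul_nine_dvd_card_centralizer ((Commute.refl _).mul_right commute_elt3_elt3Right)
    (commute_elt3_elt3Right.symm.mul_right (Commute.refl _))
    (Units.ext (by decide +kernel)) orderOf_elt5Right (by norm_num)

/-- The permutation matrix exchanging the first two coordinates with the next two. -/
def blockSwap : G :=
  ⟨!![0, 0, 1, 0, 0; 0, 0, 0, 1, 0; 1, 0, 0, 0, 0; 0, 1, 0, 0, 0; 0, 0, 0, 0, 1],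
    !![0, 0, 1, 0, 0; 0, 0, 0, 1, 0; 1, 0, 0, 0, 0; 0, 1, 0, 0, 0; 0, 0, 0, 0, 1],
    by decide, by decide⟩

/-- The permutation matrix exchanging the third and fourth coordinates. -/
def coordSwap : G :=
  ⟨!![1, 0, 0, 0, 0; 0, 1, 0, 0, 0; 0, 0, 0, 1, 0; 0, 0, 1, 0, 0; 0, 0, 0, 0, 1],
    !![1, 0, 0, 0, 0; 0, 1, 0, 0, 0; 0, 0, 0, 1, 0; 0, 0, 1, 0, 0; 0, 0, 0, 0, 1],
    by decide, by decide⟩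

theorem centralizerTwoPart_elt3Right : centralizerTwoPart elt3Right ≤ 8 := by
  have h : elt3Right = blockSwap * elt3 * blockSwap⁻¹ := Units.ext (by decide +kernel)
  rw [h, centralizerTwoPart_conj]
  exact centralizerTwoPart_elt3

theorem centralizerTwoPart_elt3_mul_elt3Right_inv :
    centralizerTwoPart (elt3 * elt3Right⁻¹) ≤ 4 := by
  have h : elt3 * elt3Right⁻¹ = coordSwap * (elt3 * elt3Right) * coordSwap⁻¹ :=
    Units.ext (by decide +kernel)
  rw [h, centralizerTwoPart_conj]
  exact centralizerTwoPart_elt3_mul_elt3Right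

theorem centralizerTwoPart_torus (c : Fin 3 × Fin 3) (hc : c ≠ 0) :
    centralizerTwoPart (elt3 ^ (c.1 : ℕ) * elt3Right ^ (c.2 : ℕ)) ≤
      if c.1 = 0 ∨ c.2 = 0 then 8 else 4 := by
  have ha : elt3 ^ 2 = elt3⁻¹ := eq_inv_of_mul_eq_one_left (by
    rw [← pow_succ]; exact orderOf_dvd_iff_pow_eq_one.1 orderOf_elt3.dvd)
  have hb : elt3Right ^ 2 = elt3Right⁻¹ := eq_inv_of_mul_eq_one_left (by
    rw [← pow_succ]; exact orderOf_dvd_iff_pow_eq_one.1 orderOf_elt3Right.dvd)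
  have hcomm := commute_elt3_elt3Right
  have hmul : elt3⁻¹ * elt3Right⁻¹ = (elt3 * elt3Right)⁻¹ := by rw [mul_inv_rev, hcomm.inv_inv.eq]
  have hdiv : elt3⁻¹ * elt3Right = (elt3 * elt3Right⁻¹)⁻¹ := by
    rw [mul_inv_rev, inv_inv, hcomm.inv_left.eq]
  obtain ⟨i, j⟩ := c
  fin_cases i <;> fin_cases j
  · exact absurd rfl hc
  · simpa using centralizerTwoPart_elt3Right
  · simpa [hb, centralizerTwoPart_inv] using centralizerTwoPart_elt3Right
  · simpa using centralizerTwoPart_elt3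
  · simpa using centralizerTwoPart_elt3_mul_elt3Right
  · simpa [hb] using centralizerTwoPart_elt3_mul_elt3Right_inv
  · simpa [ha, centralizerTwoPart_inv] using centralizerTwoPart_elt3
  · simpa [ha, hdiv, centralizerTwoPart_inv, -mul_inv_rev] using
      centralizerTwoPart_elt3_mul_elt3Right_inv
  · simpa [ha, hb, hmul, centralizerTwoPart_inv, -mul_inv_rev] using
      centralizerTwoPart_elt3_mul_elt3Right

end Torus

section GroupOrder

local notation "G" => Matrix.GeneralLinearGroup (Fin 5) (ZMod 2)

theorem card_GL5_F2 : Nat.card G = 2 ^ 10 * (3 ^ 2 * (5 * (7 * 31))) := by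
  rw [Matrix.card_GL_field]
  simp [Fin.prod_univ_five, ZMod.card]

theorem factorization_card_GL5_F2 (p : ℕ) : (Nat.card G).factorization p =
    if p = 2 then 10 else if p = 3 then 2 else if p = 5 ∨ p = 7 ∨ p = 31 then 1 else 0 := by
  have h3 : Nat.Prime 3 := by norm_num
  have h5 : Nat.Prime 5 := by norm_num
  have h7 : Nat.Prime 7 := by norm_num
  have h31 : Nat.Prime 31 := by norm_num
  rw [card_GL5_F2, Nat.factorization_mul (by norm_num) (by norm_num),
    Nat.factorization_mul (by norm_num) (by norm_num),
    Nat.factorization_mul (by norm_num) (by norm_num),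
    Nat.factorization_mul (by norm_num) (by norm_num),
    Nat.prime_two.factorization_pow, h3.factorization_pow, h5.factorization, h7.factorization,
    h31.factorization]
  simp only [Finsupp.add_apply, Finsupp.single_apply]
  split_ifs <;> omega

end GroupOrder

section Subgroups

local notation "G" => Matrix.GeneralLinearGroup (Fin 5) (ZMod 2)

theorem Sylow.exists_forall_conj_mem_sylow {K : Type*} [Group K] [Finite K] {p : ℕ}
    [Fact p.Prime] {H : Subgroup K} (P : Sylow p H) (Q : Sylow p K) :
    ∃ g : K, ∀ s ∈ P, g * (s : K) * g⁻¹ ∈ Q := by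
  obtain ⟨g, hg⟩ := (P.isPGroup'.map H.subtype).exists_conj_mem_sylow Q
  exact ⟨g, fun s hs => hg s (Subgroup.mem_map_of_mem _ hs)⟩

theorem card_conjClasses_sylow_two_le (H : Subgroup G) (P : Sylow 2 H) :
    Nat.card (ConjClasses P) ≤ 132 := by
  obtain ⟨g, hg⟩ := P.exists_forall_conj_mem_sylow
    (Sylow.ofCard unitriangular (by rw [card_unitriangular, factorization_card_GL5_F2]; rfl))
  have h := card_conjClasses_mul_card_le
    (ψ := (MulAut.conj g).toMonoidHom.comp (H.subtype.comp (P : Subgroup H).subtype))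
    ((MulAut.conj g).injective.comp (Subtype.val_injective.comp Subtype.val_injective))
    fun x => hg x x.2
  obtain ⟨n, hn⟩ := IsPGroup.iff_card.1 P.isPGroup'
  have hn' : Nat.card P = 2 ^ n := hn
  rcases lt_or_ge n 8 with hlt | hge
  · have h1 : Nat.card (ConjClasses P) ≤ Nat.card P :=
      Nat.card_le_card_of_surjective _ ConjClasses.mk_surjective
    have h2 : 2 ^ n ≤ 2 ^ 7 := Nat.pow_le_pow_right two_pos (by omega)
    omega
  · have h2 : 2 ^ 8 ≤ Nat.card P := hn' ▸ Nat.pow_le_pow_right two_pos hge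
    refine Nat.le_of_mul_le_mul_right (h.trans ?_) (Nat.card_pos (α := P))
    omega

theorem sum_centralizer_two_part_le (H : Subgroup G) (T : Sylow 3 H) :
    ∑ s ∈ ((T : Set H) \ {1}).toFinite.toFinset,
      2 ^ (Nat.card (Subgroup.centralizer {s})).factorization 2 ≤ 48 := by
  obtain ⟨g, hg⟩ := T.exists_forall_conj_mem_sylow
    (Sylow.ofCard torus (by rw [card_torus, factorization_card_GL5_F2]; rfl))
  have hex (s : H) : ∃ c : Fin 3 × Fin 3, s ∈ T →
      g * (s : G) * g⁻¹ = elt3 ^ (c.1 : ℕ) * elt3Right ^ (c.2 : ℕ) := by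
    by_cases hs : s ∈ T
    · exact (exists_eq_of_mem_torus (hg s hs)).imp fun c hc _ => hc
    · exact ⟨0, fun h => absurd h hs⟩
  choose c hc using hex
  have hmem {s : H} (hs : s ∈ ((T : Set H) \ {1}).toFinite.toFinset) : s ∈ T ∧ s ≠ 1 := by
    simpa using hs
  have hc0 {s : H} (hs : s ∈ T ∧ s ≠ 1) : c s ≠ 0 := fun h0 => hs.2 (by
    have := hc s hs.1
    rw [h0] at this
    simpa [conj_eq_one_iff] using this)
  let b : Fin 3 × Fin 3 → ℕ := fun c => if c.1 = 0 ∨ c.2 = 0 then 8 else 4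
  have hinj : Set.InjOn c ((T : Set H) \ {1}).toFinite.toFinset := by
    intro s hs t ht hst
    have h1 := hc s (hmem hs).1
    rw [hst, ← hc t (hmem ht).1] at h1
    exact Subtype.ext (by simpa using h1)
  calc ∑ s ∈ ((T : Set H) \ {1}).toFinite.toFinset,
        2 ^ (Nat.card (Subgroup.centralizer {s})).factorization 2
      ≤ ∑ s ∈ ((T : Set H) \ {1}).toFinite.toFinset, b (c s) := by
        refine Finset.sum_le_sum fun s hs => ?_
        refine le_trans ?_ (centralizerTwoPart_torus (c s) (hc0 (hmem hs)))
        rw [← hc s (hmem hs).1, centralizerTwoPart_conj]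
        exact Nat.pow_le_pow_right two_pos ((Nat.factorization_le_iff_dvd Nat.card_pos.ne'
          Nat.card_pos.ne').2 (card_centralizer_coe_dvd H s) 2)
    _ = ∑ d ∈ ((T : Set H) \ {1}).toFinite.toFinset.image c, b d :=
        (Finset.sum_image hinj).symm
    _ ≤ ∑ d ∈ Finset.univ.erase 0, b d := by
        refine Finset.sum_le_sum_of_subset fun d hd => ?_
        obtain ⟨s, hs, rfl⟩ := Finset.mem_image.1 hd
        exact Finset.mem_erase.2 ⟨hc0 (hmem hs), Finset.mem_univ _⟩
    _ = 48 := by decide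

theorem ncard_conjClasses_dvd_orderOf_subgroup_le {K : Type*} [Group K] [Finite K] {p c : ℕ}
    [Fact p.Prime] (hK : (Nat.card K).factorization p = 1) {r : K} (hr : orderOf r = p)
    (hc : Nat.card (Subgroup.centralizer {r}) ≤ p * c) (H : Subgroup K) :
    {C : ConjClasses H | ∃ x, ConjClasses.mk x = C ∧ p ∣ orderOf x}.ncard ≤ (p - 1) * c := by
  obtain ⟨T⟩ : Nonempty (Sylow p H) := inferInstance
  have hT : Nat.card T ≤ p := by
    rw [T.card_eq_multiplicity]
    have hle : (Nat.card H).factorization p ≤ 1 := hK ▸ (Nat.factorization_le_iff_dvd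
      Nat.card_pos.ne' Nat.card_pos.ne').2 H.card_subgroup_dvd_card p
    exact (Nat.pow_le_pow_right (Fact.out : p.Prime).pos hle).trans_eq (pow_one p)
  refine ncard_conjClasses_dvd_orderOf_le T hT fun s hs hs1 => ?_
  obtain ⟨k, hk⟩ := IsPGroup.iff_orderOf.1 T.isPGroup' ⟨s, hs⟩
  rw [Subgroup.orderOf_mk] at hk
  refine (Nat.le_of_dvd Nat.card_pos (card_centralizer_coe_dvd H s)).trans (le_trans ?_ hc)
  exact card_centralizer_le_of_factorization_eq_one hK hr ((Subgroup.orderOf_coe s).trans hk)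
    (by simpa using hs1)

theorem prime_dvd_card_GL5_F2 {p : ℕ} (hp : p.Prime) (h : p ∣ Nat.card G) :
    p = 2 ∨ p = 3 ∨ p = 5 ∨ p = 7 ∨ p = 31 := by
  have h1 := hp.factorization_pos_of_dvd Nat.card_pos.ne' h
  rw [factorization_card_GL5_F2] at h1
  split_ifs at h1 <;> simp_all

end Subgroups

/-- Every subgroup of `GL(5, F₂)` has fewer than `260` conjugacy classes. -/
theorem conjClasses_lt_of_subgroup_GL5_F2
    (H : Subgroup (Matrix.GeneralLinearGroup (Fin 5) (ZMod 2))) :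
    Nat.card (ConjClasses H) < 260 := by
  have : Fact (Nat.Prime 3) := ⟨by norm_num⟩
  have : Fact (Nat.Prime 5) := ⟨by norm_num⟩
  have : Fact (Nat.Prime 7) := ⟨by norm_num⟩
  have : Fact (Nat.Prime 31) := ⟨by norm_num⟩
  obtain ⟨P⟩ : Nonempty (Sylow 2 H) := inferInstance
  obtain ⟨T⟩ : Nonempty (Sylow 3 H) := inferInstance
  have h2 := (ncard_conjClasses_orderOf_eq_pow_le P).trans (card_conjClasses_sylow_two_le H P)
  have h3 := (ncard_conjClasses_orderOf_eq_pow_mul_le (q := 2) T).trans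
    (sum_centralizer_two_part_le H T)
  have h5 := ncard_conjClasses_dvd_orderOf_subgroup_le (c := 3)
    (by rw [factorization_card_GL5_F2]; rfl) orderOf_elt5 card_centralizer_elt5 H
  have h7 := ncard_conjClasses_dvd_orderOf_subgroup_le (c := 6)
    (by rw [factorization_card_GL5_F2]; rfl) orderOf_elt7 card_centralizer_elt7 H
  have h31 := ncard_conjClasses_dvd_orderOf_subgroup_le (c := 1)
    (by rw [factorization_card_GL5_F2]; rfl) orderOf_elt31 card_centralizer_elt31 H
  rw [← Set.ncard_univ]
  set A₂ := {C : ConjClasses H | ∃ x, ConjClasses.mk x = C ∧ ∃ k, orderOf x = 2 ^ k}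
  set A₃ := {C : ConjClasses H | ∃ x, ConjClasses.mk x = C ∧ 3 ∣ orderOf x ∧
    ∀ l : ℕ, l.Prime → l ∣ orderOf x → l = 2 ∨ l = 3}
  set A₅ := {C : ConjClasses H | ∃ x, ConjClasses.mk x = C ∧ 5 ∣ orderOf x}
  set A₇ := {C : ConjClasses H | ∃ x, ConjClasses.mk x = C ∧ 7 ∣ orderOf x}
  set A₃₁ := {C : ConjClasses H | ∃ x, ConjClasses.mk x = C ∧ 31 ∣ orderOf x}
  have hcover : (Set.univ : Set (ConjClasses H)) ⊆ A₂ ∪ (A₃ ∪ (A₅ ∪ (A₇ ∪ A₃₁))) := by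
    rintro C -
    obtain ⟨x, rfl⟩ := ConjClasses.mk_surjective C
    have hx (l : ℕ) (hl : l.Prime) (hlx : l ∣ orderOf x) :=
      prime_dvd_card_GL5_F2 hl
        (hlx.trans ((orderOf_dvd_natCard x).trans H.card_subgroup_dvd_card))
    by_cases hx5 : 5 ∣ orderOf x
    · exact .inr (.inr (.inl ⟨x, rfl, hx5⟩))
    by_cases hx7 : 7 ∣ orderOf x
    · exact .inr (.inr (.inr (.inl ⟨x, rfl, hx7⟩)))
    by_cases hx31 : 31 ∣ orderOf x
    · exact .inr (.inr (.inr (.inr ⟨x, rfl, hx31⟩)))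
    have hx' (l : ℕ) (hl : l.Prime) (hlx : l ∣ orderOf x) : l = 2 ∨ l = 3 := by
      rcases hx l hl hlx with rfl | rfl | rfl | rfl | rfl <;> simp_all
    by_cases hx3 : 3 ∣ orderOf x
    · exact .inr (.inl ⟨x, rfl, hx3, hx'⟩)
    refine .inl ⟨x, rfl, _, Nat.eq_prime_pow_of_unique_prime_dvd (orderOf_pos x).ne' ?_⟩
    intro l hl hlx
    rcases hx' l hl hlx with rfl | rfl
    exacts [rfl, absurd hlx hx3]
  have hle := Set.ncard_le_ncard hcover (Set.toFinite _)
  have u₁ := Set.ncard_union_le A₂ (A₃ ∪ (A₅ ∪ (A₇ ∪ A₃₁)))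
  have u₂ := Set.ncard_union_le A₃ (A₅ ∪ (A₇ ∪ A₃₁))
  have u₃ := Set.ncard_union_le A₅ (A₇ ∪ A₃₁)
  have u₄ := Set.ncard_union_le A₇ A₃₁
  omega
end
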